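/- arXiv:math/0108075 — 2 statements merged into one kernel-verified Lean document; each statement's English description precedes it below -/
import Mathlib

section
/- The negative continued fraction expansion with tail entries at least 2 is unique: if (b₁, …, b_k) and (c₁, …, c_l) are nonempty finite lists of integers with b_j ≥ 2 for all j ≥ 2 and c_j ≥ 2 for all j ≥ 2, and the negative continued fraction values satisfy [b₁, …, b_k] = [c₁, …, c_l], then k = l and b_j = c_j for all j. -/
/-- The negative continued fraction value `[b₁, …, b_k] = b₁ - 1/(b₂ - 1/(⋯ - 1/b_k))`
of a finite list of reals, defined recursively by `[b] = b` and
`[b₁, b₂, …, b_k] = b₁ - 1/[b₂, …, b_k]`.  (Value `0` on the empty list.) -/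
noncomputable def ncf : List ℝ → ℝ
  | [] => 0
  | [b] => b
  | b :: l => b - 1 / ncf l

theorem ncf_cons {l : List ℝ} (hl : l ≠ []) (b : ℝ) : ncf (b :: l) = b - 1 / ncf l := by
  cases l with
  | nil => exact absurd rfl hl
  | cons c t => rfl

theorem one_lt_ncf {l : List ℝ} (hl : l ≠ []) (h : ∀ x ∈ l, 2 ≤ x) : 1 < ncf l := by
  induction l with
  | nil => exact absurd rfl hl
  | cons b t ih =>
    have hb : 2 ≤ b := h b (by simp)
    by_cases ht : t = []
    · subst ht
      exact one_lt_two.trans_le hb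
    · have hlt : 1 < ncf t := ih ht fun x hx => h x (List.mem_cons_of_mem b hx)
      have hinv : 1 / ncf t < 1 := (div_lt_one (by linarith)).2 hlt
      rw [ncf_cons ht]
      linarith

/-- If the tail entries are at least 2, the first entry is the ceiling of the value. -/
theorem ceil_ncf_cons (b : ℤ) {l : List ℝ} (h : ∀ x ∈ l, 2 ≤ x) :
    ⌈ncf ((b : ℝ) :: l)⌉ = b := by
  by_cases hl : l = []
  · subst hl
    exact Int.ceil_intCast b
  · have hlt := one_lt_ncf hl h
    have hinv : 1 / ncf l < 1 := (div_lt_one (by linarith)).2 hlt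
    have hpos : 0 < 1 / ncf l := one_div_pos.2 (by linarith)
    rw [ncf_cons hl, Int.ceil_eq_iff]
    constructor <;> linarith

theorem ncf_cons_lt {l : List ℝ} (hl : l ≠ []) (h : ∀ x ∈ l, 2 ≤ x) (b : ℝ) :
    ncf (b :: l) < b := by
  have hpos : 0 < 1 / ncf l := one_div_pos.2 (one_pos.trans (one_lt_ncf hl h))
  rw [ncf_cons hl]
  linarith

/-- Uniqueness of the negative continued fraction expansion with tail entries at least 2:
if `(b₁, …, b_k)` and `(c₁, …, c_l)` are nonempty lists of integers with `b_j ≥ 2` and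
`c_j ≥ 2` for all `j ≥ 2`, and `[b₁, …, b_k] = [c₁, …, c_l]`, then the lists coincide
(`k = l` and `b_j = c_j` for all `j`). -/
theorem ncf_expansion_unique (L₁ L₂ : List ℤ) (h₁ : L₁ ≠ []) (h₂ : L₂ ≠ [])
    (hb₁ : ∀ x ∈ L₁.tail, (2 : ℤ) ≤ x) (hb₂ : ∀ x ∈ L₂.tail, (2 : ℤ) ≤ x)
    (hval : ncf (L₁.map (fun b => (b : ℝ))) = ncf (L₂.map (fun b => (b : ℝ)))) :
    L₁ = L₂ := by
  simp only [List.map_id_fun', id_eq, List.pure_def, List.bind_eq_flatMap,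
    ← List.map_eq_flatMap] at hval
  induction L₁ generalizing L₂ with
  | nil => exact absurd rfl h₁
  | cons b s ih =>
    cases L₂ with
    | nil => exact absurd rfl h₂
    | cons c t =>
      simp only [List.tail_cons] at hb₁ hb₂
      rw [List.map_cons, List.map_cons] at hval
      have hs : ∀ x ∈ s.map (fun b : ℤ => (b : ℝ)), 2 ≤ x :=
        List.forall_mem_map.2 fun x hx => by exact_mod_cast hb₁ x hx
      have ht : ∀ x ∈ t.map (fun b : ℤ => (b : ℝ)), 2 ≤ x :=
        List.forall_mem_map.2 fun x hx => by exact_mod_cast hb₂ x hx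
      obtain rfl : b = c := by rw [← ceil_ncf_cons b hs, hval, ceil_ncf_cons c ht]
      by_cases hs0 : s = []
      · by_cases ht0 : t = []
        · rw [hs0, ht0]
        · have hlt := ncf_cons_lt (mt List.map_eq_nil_iff.1 ht0) ht b
          rw [← hval, hs0] at hlt
          exact absurd hlt (lt_irrefl (b : ℝ))
      · by_cases ht0 : t = []
        · have hlt := ncf_cons_lt (mt List.map_eq_nil_iff.1 hs0) hs b
          rw [hval, ht0] at hlt
          exact absurd hlt (lt_irrefl (b : ℝ))
        · rw [ncf_cons (mt List.map_eq_nil_iff.1 hs0), ncf_cons (mt List.map_eq_nil_iff.1 ht0),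
            sub_right_inj, one_div, one_div, inv_inj] at hval
          rw [ih t hs0 ht0 (fun x hx => hb₁ x (List.mem_of_mem_tail hx))
            (fun x hx => hb₂ x (List.mem_of_mem_tail hx)) hval]
end

section
/- Let k ≥ 1 and let b₁, …, b_k be integers with b_j ≥ 2 for every j, and let y, x be relatively prime positive integers with negative continued fraction value [b₁, …, b_k] = y/x. Let T be the k×k integer matrix with T_{jj} = b_j, T_{j,j+1} = T_{j+1,j} = −1 for 1 ≤ j ≤ k−1, and all other entries 0. Then the cokernel ℤ^k / T(ℤ^k) is a cyclic group of order y, i.e. it is isomorphic as an additive group to ℤ/yℤ. -/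
/-- The tridiagonal `k × k` integer matrix `T` associated to a list `(b₁, …, b_k)`:
`T_{jj} = b_j`, `T_{j,j+1} = T_{j+1,j} = −1`, and `0` elsewhere. -/
def triMat (L : List ℤ) : Matrix (Fin L.length) (Fin L.length) ℤ :=
  Matrix.of fun i j =>
    if i = j then L.get i
    else if (i : ℕ) + 1 = (j : ℕ) ∨ (j : ℕ) + 1 = (i : ℕ) then -1 else 0

/-- The continuant of a list: the determinant of the tridiagonal matrix `triMat`. -/
def continuant : List ℤ → ℤ
  | [] => 1
  | [b] => b
  | b :: c :: l => b * continuant (c :: l) - continuant l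

theorem continuant_pos_and_lt (b : ℤ) (l : List ℤ) (h : ∀ x ∈ b :: l, (2 : ℤ) ≤ x) :
    0 < continuant l ∧ continuant l < continuant (b :: l) := by
  induction l generalizing b with
  | nil =>
    have := h b (by simp)
    simp only [continuant]
    omega
  | cons c l ih =>
    obtain ⟨h₁, h₂⟩ := ih c fun x hx => h x (List.mem_cons_of_mem _ hx)
    have hb := h b (by simp)
    refine ⟨h₁.trans h₂, ?_⟩
    simp only [continuant]
    nlinarith

theorem isCoprime_continuant_cons (b : ℤ) (l : List ℤ) :
    IsCoprime (continuant (b :: l)) (continuant l) := by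
  induction l generalizing b with
  | nil => exact isCoprime_one_right
  | cons c l ih =>
    obtain ⟨u, v, huv⟩ := ih c
    refine ⟨-v, u + v * b, ?_⟩
    simp only [continuant]
    linear_combination huv

theorem ncf_eq_continuant_div (b : ℤ) (l : List ℤ) (h : ∀ x ∈ b :: l, (2 : ℤ) ≤ x) :
    ncf ((b :: l).map fun b : ℤ => (b : ℝ)) = (continuant (b :: l) : ℝ) / continuant l := by
  induction l generalizing b with
  | nil => simp [ncf, continuant]
  | cons c l ih =>
    have hl : ∀ x ∈ c :: l, (2 : ℤ) ≤ x := fun x hx => h x (List.mem_cons_of_mem _ hx)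
    obtain ⟨h₁, h₂⟩ := continuant_pos_and_lt c l hl
    have h₃ : (continuant (c :: l) : ℝ) ≠ 0 := by exact_mod_cast (h₁.trans h₂).ne'
    have hc := ih c hl
    rw [List.map_cons] at hc
    simp only [List.map_cons, ncf, hc, continuant]
    push_cast
    field_simp

theorem eq_of_div_eq_div_of_isCoprime {y x p q : ℤ} (hy : 0 < y) (hx : 0 < x) (hp : 0 < p)
    (hq : 0 < q) (hyx : IsCoprime y x) (hpq : IsCoprime p q)
    (h : (y : ℝ) / x = (p : ℝ) / q) : y = p := by
  have hx' : (x : ℝ) ≠ 0 := by exact_mod_cast hx.ne'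
  have hq' : (q : ℝ) ≠ 0 := by exact_mod_cast hq.ne'
  rw [div_eq_div_iff hx' hq'] at h
  have h' : y * q = p * x := by exact_mod_cast h
  exact Int.dvd_antisymm hy.le hp.le (hyx.dvd_of_dvd_mul_right ⟨q, h'.symm⟩)
    (hpq.dvd_of_dvd_mul_right ⟨x, h'⟩)

/-- The continuant of the tail of `L` starting at position `j`, extended by `0` beyond
`L.length`. -/
def tailContinuant (L : List ℤ) (j : ℕ) : ℤ :=
  if j ≤ L.length then continuant (L.drop j) else 0

theorem tailContinuant_length (L : List ℤ) : tailContinuant L L.length = 1 := by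
  simp [tailContinuant, continuant]

theorem tailContinuant_length_add_one (L : List ℤ) : tailContinuant L (L.length + 1) = 0 := by
  simp [tailContinuant]

theorem tailContinuant_eq (L : List ℤ) (j : ℕ) (hj : j < L.length) :
    tailContinuant L j = L[j] * tailContinuant L (j + 1) - tailContinuant L (j + 2) := by
  rcases Nat.lt_or_ge (j + 1) L.length with h | h
  · simp only [tailContinuant, hj.le, h.le, show j + 2 ≤ L.length from h, if_true]
    rw [List.drop_eq_getElem_cons hj, List.drop_eq_getElem_cons h, continuant]
  · have h₁ : tailContinuant L (j + 1) = 1 := by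
      rw [show j + 1 = L.length by omega, tailContinuant_length]
    have h₂ : tailContinuant L (j + 2) = 0 := by
      rw [show j + 2 = L.length + 1 by omega, tailContinuant_length_add_one]
    rw [h₁, h₂, tailContinuant, if_pos hj.le, List.drop_eq_getElem_cons hj,
      List.drop_eq_nil_of_le h, continuant]
    ring

theorem triMat_transpose (L : List ℤ) : (triMat L).transpose = triMat L := by
  ext i j
  simp only [triMat, Matrix.transpose_apply, Matrix.of_apply]
  by_cases h : i = j
  · simp [h]
  · simp [h, Ne.symm h, or_comm]

theorem triMat_mulVec (L : List ℤ) (F : ℕ → ℤ) (hF : F (L.length + 1) = 0)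
    (j : Fin L.length) :
    (triMat L).mulVec (fun i => F (i + 1)) j =
      L[(j : ℕ)] * F (j + 1) - (if (j : ℕ) = 0 then 0 else F j) - F (j + 2) := by
  have key : ∀ i : Fin L.length, triMat L j i * F (i + 1) =
      (if (i : ℕ) = j then L[(j : ℕ)] * F (j + 1) else 0) -
        (if (i : ℕ) + 1 = j then F j else 0) - (if (i : ℕ) = j + 1 then F (j + 2) else 0) := by
    intro i
    simp only [triMat, Matrix.of_apply, Fin.ext_iff, List.get_eq_getElem]
    split_ifs <;> first | omega | simp_all
  have sum_ite (m : ℕ) (a : ℤ) : ∑ i : Fin L.length, (if (i : ℕ) = m then a else 0) =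
      if m < L.length then a else 0 := by
    rw [Fin.sum_univ_eq_sum_range (fun i => if i = m then a else 0)]
    simp
  simp only [Matrix.mulVec, dotProduct, key, Finset.sum_sub_distrib, sum_ite, j.isLt, if_true]
  congr 1
  · congr 1
    rcases Nat.eq_zero_or_eq_succ_pred (j : ℕ) with h | h
    · simp [h]
    · have h' : (j : ℕ).pred < L.length := by have := j.isLt; omega
      rw [h]
      simp only [Nat.succ_eq_add_one, Nat.add_right_cancel_iff, sum_ite, h', if_true]
      simp
  · split_ifs with h
    · rfl
    · rw [show (j : ℕ) + 2 = L.length + 1 by omega, hF]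

theorem dotProduct_triMat_mulVec (L : List ℤ) (hL : 0 < L.length) (u : Fin L.length → ℤ) :
    (fun i : Fin L.length => tailContinuant L (i + 1)) ⬝ᵥ (triMat L).mulVec u =
      continuant L * u ⟨0, hL⟩ := by
  have h : (triMat L).mulVec (fun i : Fin L.length => tailContinuant L (i + 1)) =
      Pi.single ⟨0, hL⟩ (continuant L) := by
    ext j
    rw [triMat_mulVec L _ (tailContinuant_length_add_one L)]
    have hj := tailContinuant_eq L j j.isLt
    by_cases h0 : (j : ℕ) = 0
    · obtain rfl : j = ⟨0, hL⟩ := Fin.ext h0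
      have : tailContinuant L 0 = continuant L := by simp [tailContinuant]
      simp only [if_true, Pi.single_eq_same] at hj ⊢
      linarith
    · rw [Pi.single_eq_of_ne (fun h => h0 (congrArg Fin.val h)), if_neg h0]
      linarith
  rw [Matrix.dotProduct_mulVec, ← Matrix.mulVec_transpose, triMat_transpose, h,
    single_dotProduct]

/-- The solution of the recurrence `u (j + 2) = b j * u (j + 1) - u j - v j` with `u 0 = 0` and
`u 1 = c`. -/
def shootingSeq (b v : ℕ → ℤ) (c : ℤ) : ℕ → ℤ
  | 0 => 0
  | 1 => c
  | j + 2 => b j * shootingSeq b v c (j + 1) - shootingSeq b v c j - v j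

theorem shootingSeq_casoratian (L : List ℤ) (b v : ℕ → ℤ) (c : ℤ)
    (hb : ∀ j (hj : j < L.length), b j = L[j]) (j : ℕ) (hj : j ≤ L.length) :
    shootingSeq b v c (j + 1) * tailContinuant L j -
        shootingSeq b v c j * tailContinuant L (j + 1) =
      c * continuant L - ∑ i ∈ Finset.range j, tailContinuant L (i + 1) * v i := by
  induction j with
  | zero => simp [shootingSeq, tailContinuant]
  | succ j ih =>
    have h₁ := ih (by omega)
    have h₂ := tailContinuant_eq L j hj
    rw [← hb j hj] at h₂
    rw [Finset.sum_range_succ, shootingSeq]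
    linear_combination h₁ - shootingSeq b v c (j + 1) * h₂

theorem mem_range_triMat_iff (L : List ℤ) (hL : 0 < L.length) (v : Fin L.length → ℤ) :
    v ∈ LinearMap.range (Matrix.toLin' (triMat L)) ↔
      continuant L ∣ (fun i : Fin L.length => tailContinuant L (i + 1)) ⬝ᵥ v := by
  constructor
  · rintro ⟨u, rfl⟩
    rw [Matrix.toLin'_apply, dotProduct_triMat_mulVec L hL]
    exact dvd_mul_right _ _
  · rintro ⟨c, hc⟩
    set b : ℕ → ℤ := fun j => if h : j < L.length then L[j] else 0
    set w : ℕ → ℤ := fun j => if h : j < L.length then v ⟨j, h⟩ else 0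
    have hb : ∀ j (hj : j < L.length), b j = L[j] := fun j hj => dif_pos hj
    have hw : ∀ j : Fin L.length, w j = v j := fun j => dif_pos j.isLt
    have hend : shootingSeq b w c (L.length + 1) = 0 := by
      have h := shootingSeq_casoratian L b w c hb L.length le_rfl
      rw [tailContinuant_length, tailContinuant_length_add_one,
        ← Fin.sum_univ_eq_sum_range (fun i => tailContinuant L (i + 1) * w i)] at h
      simp only [hw] at h
      simp only [dotProduct] at hc
      linarith
    refine ⟨fun i => shootingSeq b w c (i + 1), ?_⟩
    ext j
    rw [Matrix.toLin'_apply, triMat_mulVec L _ hend, shootingSeq, hb j j.isLt, hw j]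
    split_ifs with h
    · have h0 : shootingSeq b w c j = 0 := by rw [h, shootingSeq]
      rw [h0]
      ring
    · ring

/-- If `k ≥ 1`, `b_j ≥ 2` for every `j`, and `[b₁, …, b_k] = y/x` with `y, x`
relatively prime positive integers, then the cokernel `ℤᵏ / T(ℤᵏ)` of the tridiagonal
matrix `T` is cyclic of order `y`, i.e. isomorphic as an additive group to `ℤ/yℤ`. -/
theorem cokernel_triMat (L : List ℤ) (hL : L ≠ []) (hb : ∀ x ∈ L, (2 : ℤ) ≤ x)
    (y x : ℤ) (hy : 0 < y) (hx : 0 < x) (hcop : IsCoprime y x)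
    (hval : ncf (L.map (fun b => (b : ℝ))) = (y : ℝ) / (x : ℝ)) :
    Nonempty
      (((Fin L.length → ℤ) ⧸ LinearMap.range (Matrix.toLin' (triMat L))) ≃+
        ZMod y.toNat) := by
  obtain ⟨b, l, rfl⟩ := List.exists_cons_of_ne_nil hL
  obtain ⟨hl, hlt⟩ := continuant_pos_and_lt b l hb
  rw [bind_pure_comp, List.map_eq_map, List.map_id', ncf_eq_continuant_div b l hb] at hval
  obtain rfl := eq_of_div_eq_div_of_isCoprime hy hx (hl.trans hlt) hl hcop
    (isCoprime_continuant_cons b l) hval.symm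
  set L := b :: l
  have hlen : 0 < L.length := by simp [L]
  set n := (continuant L).toNat
  have hn : (n : ℤ) = continuant L := Int.toNat_of_nonneg hy.le
  let w : Fin L.length → ℤ := fun i => tailContinuant L (i + 1)
  let φ : (Fin L.length → ℤ) →ₗ[ℤ] ZMod n :=
    (Int.castAddHom (ZMod n)).toIntLinearMap ∘ₗ ∑ i, w i • LinearMap.proj i
  have hφ (v : Fin L.length → ℤ) : φ v = ((w ⬝ᵥ v : ℤ) : ZMod n) := by
    simp [φ, dotProduct]
  have hker : LinearMap.range (Matrix.toLin' (triMat L)) = LinearMap.ker φ := by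
    ext v
    rw [mem_range_triMat_iff L hlen, LinearMap.mem_ker, hφ, ZMod.intCast_zmod_eq_zero_iff_dvd, hn]
  have hsurj : Function.Surjective φ := by
    intro z
    obtain ⟨a, rfl⟩ := ZMod.intCast_surjective z
    have hlast : w ⟨L.length - 1, by omega⟩ = 1 := by
      simp only [w, Nat.sub_add_cancel hlen, tailContinuant_length]
    refine ⟨Pi.single ⟨L.length - 1, by omega⟩ a, ?_⟩
    rw [hφ, dotProduct_single, hlast, one_mul]
  exact ⟨((Submodule.quotEquivOfEq _ _ hker).trans
    (φ.quotKerEquivOfSurjective hsurj)).toAddEquiv⟩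
end
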